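/- Let Ω ⊆ ℝ² be a non-special bounded convex polygonal domain with 2n edges all of length 1, with vertices p_0, …, p_{2n−1} in positively oriented cyclic order, let u be a Jenkins–Serrin graph on Ω, and let ψ̄ : closure(Ω) → ℝ be the continuous extension of a conjugate function of u, normalized so that ψ̄(p_0) = 0. Then ψ̄(p_i) = 0 for every even index i and ψ̄(p_i) = 1 for every odd index i; ψ̄ restricted to each edge of the boundary of Ω is an affine function; and 0 ≤ ψ̄ ≤ 1 on the closure of Ω. -/

import Mathlib

open Set Filter Topology Metric
open scoped RealInnerProductSpace

noncomputable section

/-- The plane `ℝ²` with the Euclidean metric. -/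
abbrev Pt : Type := EuclideanSpace ℝ (Fin 2)

/-- The point of `ℝ²` with coordinates `(a, b)`. -/
def vec2 (a b : ℝ) : Pt := (WithLp.equiv 2 (Fin 2 → ℝ)).symm ![a, b]

/-- `W_u = √(1 + ‖∇u‖²)`. -/
def Wu (u : Pt → ℝ) (p : Pt) : ℝ := Real.sqrt (1 + ‖gradient u p‖ ^ 2)

/-- The conjugate vector field `F_u = (−∂₂u/W_u, ∂₁u/W_u)` of a minimal graph `u`. -/
def conjField (u : Pt → ℝ) (p : Pt) : Pt :=
  (Wu u p)⁻¹ • vec2 (-(gradient u p 1)) (gradient u p 0)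

/-- `u` is a minimal graph on the open set `Ω`: it is `C²` on `Ω` and satisfies the minimal
surface equation `div (∇u / √(1 + ‖∇u‖²)) = 0` there, the divergence being the sum of the
partial derivatives of the components of the normalized gradient field. -/
def MinimalGraph (Ω : Set Pt) (u : Pt → ℝ) : Prop :=
  IsOpen Ω ∧ ContDiffOn ℝ 2 u Ω ∧
    ∀ p ∈ Ω, (∑ i : Fin 2,
      fderiv ℝ (fun q => (Wu u q)⁻¹ • gradient u q) p (EuclideanSpace.single i 1) i) = 0

/-- `ψ` is a conjugate function of `u` on `Ω`: it is differentiable with `∇ψ = F_u` on `Ω`. -/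
def IsConjugate (Ω : Set Pt) (u ψ : Pt → ℝ) : Prop :=
  ∀ p ∈ Ω, DifferentiableAt ℝ ψ p ∧ gradient ψ p = conjField u p

/-- The planar cross product `v₁ w₂ − v₂ w₁`. -/
def cross2 (v w : Pt) : ℝ := v 0 * w 1 - v 1 * w 0

/-- A bounded convex polygonal domain with `2n` edges, all of length one, whose vertices
`vtx 0, vtx 1, …` are listed in positively oriented cyclic order. -/
structure UnitPolygon (n : ℕ) : Type where
  n_ge : 2 ≤ n
  Ω : Set Pt
  vtx : ZMod (2 * n) → Pt
  isOpen : IsOpen Ω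
  convex : Convex ℝ Ω
  isBounded : Bornology.IsBounded Ω
  nonempty : Ω.Nonempty
  inj : Function.Injective vtx
  unit_edges : ∀ i, dist (vtx i) (vtx (i + 1)) = 1
  frontier_eq : frontier Ω = ⋃ i, segment ℝ (vtx i) (vtx (i + 1))
  pos_orient : ∀ i, 0 ≤ cross2 (vtx (i + 1) - vtx i) (vtx (i + 2) - vtx (i + 1))

/-- A bounded unit polygon with `2n` edges is special if `n ≥ 3` and its boundary is a
parallelogram with two sides of length one and two sides of length `n − 1`. -/
def UnitPolygon.IsSpecial {n : ℕ} (P : UnitPolygon n) : Prop :=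
  3 ≤ n ∧ ∃ q v w : Pt, ‖v‖ = 1 ∧ ‖w‖ = (n : ℝ) - 1 ∧
    frontier P.Ω = segment ℝ q (q + v) ∪ segment ℝ (q + v) (q + v + w) ∪
      segment ℝ (q + v + w) (q + w) ∪ segment ℝ (q + w) q

/-- The Jenkins–Serrin graph on a unit polygon: a minimal graph taking boundary values
`+∞` on the edges `(vtx (2i), vtx (2i+1))` and `−∞` on the edges `(vtx (2i−1), vtx (2i))`. -/
def JSGraph {n : ℕ} (P : UnitPolygon n) (u : Pt → ℝ) : Prop :=
  MinimalGraph P.Ω u ∧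
    ∀ i : ZMod (2 * n), ∀ t ∈ openSegment ℝ (P.vtx i) (P.vtx (i + 1)),
      (Even i.val → Tendsto u (𝓝[P.Ω] t) atTop) ∧
      (¬ Even i.val → Tendsto u (𝓝[P.Ω] t) atBot)

/-- The normalized gradient field. -/
def nG (u : Pt → ℝ) (q : Pt) : Pt := (Wu u q)⁻¹ • gradient u q

theorem inner2 (x y : Pt) : ⟪x, y⟫ = x 0 * y 0 + x 1 * y 1 := by
  simp [PiLp.inner_apply, Fin.sum_univ_two]; ring

theorem normsq2 (x : Pt) : ‖x‖ ^ 2 = x 0 ^ 2 + x 1 ^ 2 := by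
  rw [← real_inner_self_eq_norm_sq, inner2]; ring

@[simp] theorem vec2_zero (a b : ℝ) : vec2 a b 0 = a := by simp [vec2]
@[simp] theorem vec2_one (a b : ℝ) : vec2 a b 1 = b := by simp [vec2]

theorem Wu_pos (u : Pt → ℝ) (q : Pt) : 0 < Wu u q := by
  unfold Wu; positivity

theorem conjField_eq (u : Pt → ℝ) (q : Pt) :
    conjField u q = vec2 (-(nG u q 1)) (nG u q 0) := by
  ext i; fin_cases i <;> simp [conjField, nG]

theorem norm_nG_le (u : Pt → ℝ) (q : Pt) : ‖nG u q‖ ≤ 1 := by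
  rw [nG, norm_smul, norm_inv, Real.norm_of_nonneg (Wu_pos u q).le, inv_mul_le_iff₀ (Wu_pos u q),
    mul_one, Wu]
  apply Real.le_sqrt_of_sq_le; linarith

theorem norm_conjField_le (u : Pt → ℝ) (q : Pt) : ‖conjField u q‖ ≤ 1 := by
  have h := norm_nG_le u q
  have : ‖conjField u q‖ ^ 2 = ‖nG u q‖ ^ 2 := by
    rw [normsq2, normsq2, conjField_eq]; simp; ring
  rw [← abs_of_nonneg (norm_nonneg (conjField u q)), ← abs_of_nonneg (norm_nonneg (nG u q))] at *
  rw [sq_eq_sq_iff_abs_eq_abs] at this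
  simp at this h ⊢
  linarith

theorem gmono (p q : Pt) :
    0 ≤ ⟪p - q, (Real.sqrt (1 + ‖p‖ ^ 2))⁻¹ • p - (Real.sqrt (1 + ‖q‖ ^ 2))⁻¹ • q⟫ := by
  set P := Real.sqrt (1 + ‖p‖ ^ 2) with hP
  set Q := Real.sqrt (1 + ‖q‖ ^ 2) with hQ
  have hP0 : 0 < P := by positivity
  have hQ0 : 0 < Q := by positivity
  have hP2 : P ^ 2 = 1 + ‖p‖ ^ 2 := Real.sq_sqrt (by positivity)
  have hQ2 : Q ^ 2 = 1 + ‖q‖ ^ 2 := Real.sq_sqrt (by positivity)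
  have hc : ⟪p, q⟫ ≤ P * Q - 1 := by
    have h1 := real_inner_le_norm p q
    have h2 : (1 + ‖p‖ * ‖q‖) ^ 2 ≤ (P * Q) ^ 2 := by
      rw [mul_pow, hP2, hQ2]; nlinarith [sq_nonneg (‖p‖ - ‖q‖)]
    have h3 := abs_le_of_sq_le_sq' h2 (by positivity)
    linarith [h3.2]
  simp only [inner_sub_left, inner_sub_right, inner_smul_right, real_inner_self_eq_norm_sq]
  rw [real_inner_comm p q]
  have e1 : ‖p‖ ^ 2 = P ^ 2 - 1 := by linarith
  have e2 : ‖q‖ ^ 2 = Q ^ 2 - 1 := by linarith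
  rw [e1, e2]
  have h5 : 0 ≤ (P⁻¹ + Q⁻¹) * (P * Q - 1 - ⟪p, q⟫) := by
    apply mul_nonneg (by positivity); linarith
  have e3 : (P⁻¹ + Q⁻¹) * (P * Q - 1 - ⟪p, q⟫) =
     P⁻¹ * (P ^ 2 - 1) - Q⁻¹ * ⟪p, q⟫ - (P⁻¹ * ⟪p, q⟫ - Q⁻¹ * (Q ^ 2 - 1)) := by
    field_simp; ring
  linarith

theorem grad_contDiffOn {Ω : Set Pt} {u : Pt → ℝ} (ho : IsOpen Ω) (hu : ContDiffOn ℝ 2 u Ω) :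
    ContDiffOn ℝ 1 (gradient u) Ω := by
  have h : ContDiffOn ℝ 1 (fderiv ℝ u) Ω := hu.fderiv_of_isOpen ho (by norm_num)
  exact (InnerProductSpace.toDual ℝ Pt).symm.contDiff.comp_contDiffOn h

theorem Wu_contDiffOn {Ω : Set Pt} {u : Pt → ℝ} (ho : IsOpen Ω) (hu : ContDiffOn ℝ 2 u Ω) :
    ContDiffOn ℝ 1 (Wu u) Ω := by
  have h := grad_contDiffOn ho hu
  unfold Wu
  exact (contDiffOn_const.add (h.norm_sq ℝ)).sqrt (fun x _ => by positivity)

theorem nG_contDiffOn {Ω : Set Pt} {u : Pt → ℝ} (ho : IsOpen Ω) (hu : ContDiffOn ℝ 2 u Ω) :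
    ContDiffOn ℝ 1 (nG u) Ω :=
  ((Wu_contDiffOn ho hu).inv (fun x _ => (Wu_pos u x).ne')).smul (grad_contDiffOn ho hu)

/-- The divergence of a planar field. -/
def dv (X : Pt → Pt) (p : Pt) : ℝ := ∑ i : Fin 2, fderiv ℝ X p (EuclideanSpace.single i 1) i

theorem pt_decomp (v : Pt) :
    v = v 0 • EuclideanSpace.single (0 : Fin 2) (1 : ℝ) + v 1 • EuclideanSpace.single 1 1 := by
  ext i; fin_cases i <;> simp

/-- Rotation by a quarter turn. -/
def rot (v : Pt) : Pt := vec2 (-(v 1)) (v 0)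

@[simp] theorem rot_zero (v : Pt) : rot v 0 = -(v 1) := by simp [rot]
@[simp] theorem rot_one (v : Pt) : rot v 1 = v 0 := by simp [rot]

theorem dv_frame (X : Pt → Pt) (p e : Pt) (he : ‖e‖ = 1) :
    ⟪fderiv ℝ X p e, e⟫ + ⟪fderiv ℝ X p (rot e), rot e⟫ = dv X p := by
  have h := normsq2 e
  rw [he] at h
  rw [dv, Fin.sum_univ_two]
  conv_lhs => rw [inner2, inner2]
  rw [show fderiv ℝ X p e = _ by conv_lhs => rw [pt_decomp e]; rw [map_add, map_smul, map_smul]]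
  rw [show fderiv ℝ X p (rot e) = _ by
    conv_lhs => rw [pt_decomp (rot e)]; rw [map_add, map_smul, map_smul]]
  simp
  set A := fderiv ℝ X p (EuclideanSpace.single 0 1)
  set B := fderiv ℝ X p (EuclideanSpace.single 1 1)
  linear_combination -(A 0 + B 1) * h

/-- Coordinates adapted to an edge. -/
def Phi (o e : Pt) (x y : ℝ) : Pt := o + x • e + y • rot e

theorem Phi_hasFDerivAt (o e : Pt) (z : ℝ × ℝ) :
    HasFDerivAt (fun z : ℝ × ℝ => Phi o e z.1 z.2)
      ((ContinuousLinearMap.fst ℝ ℝ ℝ).smulRight e +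
        (ContinuousLinearMap.snd ℝ ℝ ℝ).smulRight (rot e)) z := by
  unfold Phi
  exact ((hasFDerivAt_fst.smul_const e).const_add o).add (hasFDerivAt_snd.smul_const (rot e))

theorem Phi_continuous (o e : Pt) : Continuous (fun z : ℝ × ℝ => Phi o e z.1 z.2) := by
  unfold Phi; fun_prop

theorem div_rect {Ω : Set Pt} (ho : IsOpen Ω) {X : Pt → Pt} (hX : ContDiffOn ℝ 1 X Ω)
    (o e : Pt) (he : ‖e‖ = 1) {a b c d : ℝ} (hab : a ≤ b) (hcd : c ≤ d)
    (hin : ∀ x ∈ Icc a b, ∀ y ∈ Icc c d, Phi o e x y ∈ Ω)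
    (hdiv : ∀ p ∈ Ω, 0 ≤ dv X p) :
    0 ≤ (∫ x in a..b, ⟪X (Phi o e x d), rot e⟫) - (∫ x in a..b, ⟪X (Phi o e x c), rot e⟫)
      + (∫ y in c..d, ⟪X (Phi o e b y), e⟫) - ∫ y in c..d, ⟪X (Phi o e a y), e⟫ := by
  set T : ℝ × ℝ →L[ℝ] Pt := (ContinuousLinearMap.fst ℝ ℝ ℝ).smulRight e +
        (ContinuousLinearMap.snd ℝ ℝ ℝ).smulRight (rot e) with hT
  set R : Set (ℝ × ℝ) := (uIcc a b) ×ˢ (uIcc c d) with hR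
  have hmem : ∀ z ∈ R, Phi o e z.1 z.2 ∈ Ω := by
    rintro ⟨x, y⟩ ⟨h1, h2⟩
    rw [uIcc_of_le hab] at h1; rw [uIcc_of_le hcd] at h2
    exact hin x h1 y h2
  have hXc : ContinuousOn (fun z : ℝ × ℝ => X (Phi o e z.1 z.2)) R :=
    hX.continuousOn.comp (Phi_continuous o e).continuousOn hmem
  have hDc : ContinuousOn (fun z : ℝ × ℝ => fderiv ℝ X (Phi o e z.1 z.2)) R :=
    (hX.continuousOn_fderiv_of_isOpen ho le_rfl).comp (Phi_continuous o e).continuousOn hmem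
  have hder : ∀ v : Pt, ∀ z ∈ R, HasFDerivAt (fun z : ℝ × ℝ => ⟪X (Phi o e z.1 z.2), v⟫)
      ((innerSL ℝ v).comp ((fderiv ℝ X (Phi o e z.1 z.2)).comp T)) z := by
    intro v z hz
    have h1 : HasFDerivAt X (fderiv ℝ X (Phi o e z.1 z.2)) (Phi o e z.1 z.2) :=
      ((hX.differentiableOn one_ne_zero).differentiableAt
        (ho.mem_nhds (hmem z hz))).hasFDerivAt
    have h2 := h1.comp z (Phi_hasFDerivAt o e z)
    have h3 := (innerSL ℝ v).hasFDerivAt.comp z h2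
    refine h3.congr_of_eventuallyEq (Eventually.of_forall fun w => ?_)
    simp [real_inner_comm]
  have hsub : Ioo (min a b) (max a b) ×ˢ Ioo (min c d) (max c d) ⊆ R :=
    Set.prod_mono (Ioo_subset_Icc_self (a := min a b)) (Ioo_subset_Icc_self (a := min c d))
  have hval : ∀ z : ℝ × ℝ,
      ((innerSL ℝ e).comp ((fderiv ℝ X (Phi o e z.1 z.2)).comp T)) (1, 0) +
      ((innerSL ℝ (rot e)).comp ((fderiv ℝ X (Phi o e z.1 z.2)).comp T)) (0, 1)
      = dv X (Phi o e z.1 z.2) := by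
    intro z
    rw [← dv_frame X _ e he]
    simp [hT, real_inner_comm]
  have key := MeasureTheory.integral2_divergence_prod_of_hasFDerivAt
    (fun z : ℝ × ℝ => ⟪X (Phi o e z.1 z.2), e⟫) (fun z : ℝ × ℝ => ⟪X (Phi o e z.1 z.2), rot e⟫)
    _ _ a c b d (hXc.inner continuousOn_const) (hXc.inner continuousOn_const)
    (fun z hz => hder e z (hsub hz)) (fun z hz => hder (rot e) z (hsub hz))
    (by
      simp only [hval]
      refine ContinuousOn.integrableOn_compact (isCompact_uIcc.prod isCompact_uIcc) ?_
      unfold dv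
      refine continuousOn_finsetSum _ fun i _ => ?_
      have := hDc.clm_apply (continuousOn_const (c := EuclideanSpace.single i (1 : ℝ)))
      exact (EuclideanSpace.proj (𝕜 := ℝ) i).continuous.comp_continuousOn this)
  have h0 : 0 ≤ ∫ x in a..b, ∫ y in c..d, dv X (Phi o e x y) := by
    refine intervalIntegral.integral_nonneg hab fun x hx => ?_
    exact intervalIntegral.integral_nonneg hcd fun y hy => hdiv _ (hin x hx y hy)
  have hval2 : ∀ x y : ℝ, _ = dv X (Phi o e x y) := fun x y => hval (x, y)
  simp only at hval2
  simp only [hval2] at key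
  linarith

theorem dv_cut {Ω : Set Pt} {u : Pt → ℝ} (hu : MinimalGraph Ω u) (o ν : Pt) (M k : ℝ)
    (hM : 0 ≤ M) (hν : ‖ν‖ = 1) (p : Pt) (hp : p ∈ Ω) :
    0 ≤ dv (fun q => Real.smoothTransition (u q + M * ⟪ν, q - o⟫ - k) •
      (nG u q + (M / Real.sqrt (1 + M ^ 2)) • ν)) p := by
  obtain ⟨ho, hc, heq⟩ := hu
  have hnb := ho.mem_nhds hp
  have hud : HasFDerivAt u (fderiv ℝ u p) p :=
    ((hc.differentiableOn two_ne_zero).differentiableAt hnb).hasFDerivAt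
  have hw : HasFDerivAt (fun q => u q + M * ⟪ν, q - o⟫ - k)
      (fderiv ℝ u p + M • innerSL ℝ ν) p := by
    have h1 : HasFDerivAt (fun q => ⟪ν, q - o⟫) (innerSL ℝ ν) p := by
      have := (innerSL ℝ ν).hasFDerivAt.comp p ((hasFDerivAt_id p).sub_const o)
      simpa [Function.comp_def] using this
    exact (hud.add (h1.const_mul M)).sub_const k
  have hη : HasDerivAt Real.smoothTransition
      (deriv Real.smoothTransition (u p + M * ⟪ν, p - o⟫ - k)) (u p + M * ⟪ν, p - o⟫ - k) :=
    ((Real.smoothTransition.contDiff (n := 1)).differentiable one_ne_zero _).hasDerivAt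
  have hη0 : 0 ≤ deriv Real.smoothTransition (u p + M * ⟪ν, p - o⟫ - k) :=
    Real.smoothTransition.monotone.deriv_nonneg
  have hs := hη.comp_hasFDerivAt p hw
  have hG : HasFDerivAt (nG u) (fderiv ℝ (nG u) p) p :=
    (((nG_contDiffOn ho hc).differentiableOn one_ne_zero).differentiableAt hnb).hasFDerivAt
  have hX : HasFDerivAt (fun q => Real.smoothTransition (u q + M * ⟪ν, q - o⟫ - k) •
      (nG u q + (M / Real.sqrt (1 + M ^ 2)) • ν)) _ p :=
    hs.smul (hG.add_const ((M / Real.sqrt (1 + M ^ 2)) • ν))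
  have hX' := hX.fderiv
  have hdG : dv (nG u) p = 0 := heq p hp
  have hm := gmono (gradient u p) (-(M • ν))
  have hn : ‖-(M • ν)‖ = M := by rw [norm_neg, norm_smul, hν, Real.norm_of_nonneg hM, mul_one]
  rw [hn] at hm
  have hgi : ∀ v, fderiv ℝ u p v = ⟪gradient u p, v⟫ := by
    intro v; rw [← toDual_gradient]; simp
  simp only [dv, Function.comp_def] at hX' hdG ⊢
  rw [hX']
  rw [Fin.sum_univ_two] at hdG ⊢
  have hVe : (Real.sqrt (1 + ‖gradient u p‖ ^ 2))⁻¹ • gradient u p -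
      (Real.sqrt (1 + M ^ 2))⁻¹ • -(M • ν) = nG u p + (M / Real.sqrt (1 + M ^ 2)) • ν := by
    rw [nG, Wu, smul_neg, sub_neg_eq_add, smul_smul, div_eq_inv_mul]
  rw [hVe] at hm
  set V := nG u p + (M / Real.sqrt (1 + M ^ 2)) • ν with hV
  set η' := deriv Real.smoothTransition (u p + M * ⟪ν, p - o⟫ - k)
  set η := Real.smoothTransition (u p + M * ⟪ν, p - o⟫ - k)
  rw [inner2] at hm
  have := mul_nonneg hη0 hm
  simp only [add_apply, smul_apply, ContinuousLinearMap.smulRight_apply, hgi, innerSL_apply_apply,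
    inner2, PiLp.add_apply, PiLp.smul_apply, smul_eq_mul,
    sub_neg_eq_add] at this ⊢
  simp only [PiLp.single_apply, if_true, Fin.zero_eq_one_iff, Fin.one_eq_zero_iff,
    OfNat.ofNat_ne_one, if_false]
  norm_num
  linear_combination this - η * hdG

theorem inner_rot_self (e : Pt) : ⟪rot e, e⟫ = 0 := by rw [inner2]; simp; ring

theorem norm_rot (e : Pt) : ‖rot e‖ = ‖e‖ := by
  have : ‖rot e‖ ^ 2 = ‖e‖ ^ 2 := by rw [normsq2, normsq2]; simp; ring
  exact (sq_eq_sq₀ (norm_nonneg _) (norm_nonneg _)).1 this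

theorem flux_M {Ω : Set Pt} {u ψ : Pt → ℝ} (hu : MinimalGraph Ω u)
    (hcont : ContinuousOn ψ (closure Ω)) (hg : IsConjugate Ω u ψ)
    (o e : Pt) (he : ‖e‖ = 1) {a b δ M : ℝ} (hab : a ≤ b) (hδ : 0 < δ) (hM : 0 ≤ M)
    (hin : ∀ x ∈ Icc a b, ∀ y ∈ Ioc 0 δ, Phi o e x y ∈ Ω)
    (hlim : ∀ x ∈ Icc a b, Tendsto u (𝓝[Ω] (Phi o e x 0)) atTop) :
    M / Real.sqrt (1 + M ^ 2) * (b - a) - 2 * δ ≤ ψ (Phi o e b 0) - ψ (Phi o e a 0) := by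
  set lam := M / Real.sqrt (1 + M ^ 2) with hlam
  have ho := hu.1
  have hc := hu.2.1
  have hPhiw : ∀ x y, ⟪rot e, Phi o e x y - o⟫ = y := by
    intro x y
    have h1 : Phi o e x y - o = x • e + y • rot e := by unfold Phi; abel
    rw [h1, inner_add_right, inner_smul_right, inner_smul_right, inner_rot_self,
      real_inner_self_eq_norm_sq, norm_rot, he]; ring
  -- upper bound on the top side
  obtain ⟨k, hk⟩ : ∃ k, ∀ x ∈ Icc a b, u (Phi o e x δ) + M * δ ≤ k := by
    have hcx : ContinuousOn (fun x => u (Phi o e x δ) + M * δ) (Icc a b) := by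
      refine ContinuousOn.add ?_ continuousOn_const
      refine hc.continuousOn.comp (f := fun x => Phi o e x δ) (t := Ω) ?_
        (fun x hx => hin x hx δ ⟨hδ, le_rfl⟩)
      unfold Phi; fun_prop
    obtain ⟨k, hk⟩ := (isCompact_Icc.image_of_continuousOn hcx).bddAbove
    exact ⟨k, fun x hx => hk ⟨x, hx, rfl⟩⟩
  have hev : ∀ᶠ y in 𝓝 (0 : ℝ), ∀ x ∈ Icc a b,
      (Phi o e x y ∈ Ω → k + 1 ≤ u (Phi o e x y)) := by
    refine isCompact_Icc.eventually_forall_of_forall_eventually fun x hx => ?_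
    have h1 := (hlim x hx).eventually_ge_atTop (k + 1)
    rw [eventually_nhdsWithin_iff] at h1
    have h2 : Tendsto (fun z : ℝ × ℝ => Phi o e z.2 z.1) (𝓝 (0, x)) (𝓝 (Phi o e x 0)) := by
      have : Continuous (fun z : ℝ × ℝ => Phi o e z.2 z.1) := by unfold Phi; fun_prop
      exact this.tendsto (0, x)
    exact h2.eventually h1
  set X : Pt → Pt := fun q => Real.smoothTransition (u q + M * ⟪rot e, q - o⟫ - k) •
      (nG u q + lam • rot e) with hXdef
  have hX : ContDiffOn ℝ 1 X Ω := by
    suffices hs1 : ContDiffOn ℝ 1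
        (fun q => Real.smoothTransition (u q + M * ⟪rot e, q - o⟫ - k)) Ω by
      exact hs1.smul ((nG_contDiffOn ho hc).add contDiffOn_const)
    refine (Real.smoothTransition.contDiff (n := 1)).comp_contDiffOn ?_
    refine ((hc.of_le (by norm_num)).add ?_).sub contDiffOn_const
    exact (contDiff_const.mul (contDiff_const.inner ℝ (contDiff_id.sub contDiff_const))).contDiffOn
  have hdiv : ∀ p ∈ Ω, 0 ≤ dv X p := fun p hp =>
    dv_cut hu o (rot e) M k hM (by rw [norm_rot, he]) p hp
  have hXe : ∀ q, |⟪X q, e⟫| ≤ 1 := by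
    intro q
    have h1 : ⟪X q, e⟫ = Real.smoothTransition (u q + M * ⟪rot e, q - o⟫ - k) * ⟪nG u q, e⟫ := by
      rw [hXdef]
      simp only [inner_smul_left, inner_add_left, inner_rot_self]; simp
    rw [h1, abs_mul, abs_of_nonneg (Real.smoothTransition.nonneg _)]
    have h2 : |⟪nG u q, e⟫| ≤ 1 := by
      have := abs_real_inner_le_norm (nG u q) e
      rw [he, mul_one] at this
      exact this.trans (norm_nG_le u q)
    exact mul_le_one₀ (Real.smoothTransition.le_one _) (abs_nonneg _) h2
  have hmain : ∀ᶠ y in 𝓝[>] (0 : ℝ),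
      lam * (b - a) - 2 * δ ≤ ψ (Phi o e b y) - ψ (Phi o e a y) := by
    filter_upwards [hev.filter_mono nhdsWithin_le_nhds, Ioo_mem_nhdsGT hδ] with y hy hy2
    have hyi : ∀ x ∈ Icc a b, Phi o e x y ∈ Ω := fun x hx => hin x hx y ⟨hy2.1, hy2.2.le⟩
    have h := div_rect ho hX o e he hab hy2.2.le
      (fun x hx z hz => hin x hx z ⟨hy2.1.trans_le hz.1, hz.2⟩) hdiv
    have htop : (∫ x in a..b, ⟪X (Phi o e x δ), rot e⟫) = 0 := by
      rw [intervalIntegral.integral_congr (g := fun _ => (0 : ℝ))]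
      · simp
      · intro x hx
        rw [uIcc_of_le hab] at hx
        have : X (Phi o e x δ) = 0 := by
          simp only [hXdef, hPhiw]
          rw [Real.smoothTransition.zero_of_nonpos (by linarith [hk x hx]), zero_smul]
        simp [this]
    have hbot : (∫ x in a..b, ⟪X (Phi o e x y), rot e⟫) =
        (-ψ (Phi o e b y) + lam * b) - (-ψ (Phi o e a y) + lam * a) := by
      refine intervalIntegral.integral_eq_sub_of_hasDerivAt
        (f := fun x => -ψ (Phi o e x y) + lam * x) ?_ ?_
      · intro x hx
        rw [uIcc_of_le hab] at hx
        have hq := hyi x hx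
        have hPd : HasDerivAt (fun x => Phi o e x y) e x := by
          unfold Phi
          simpa using (((hasDerivAt_id x).smul_const e).const_add o).add_const (y • rot e)
        have h1 := (hg _ hq).1.hasFDerivAt.comp_hasDerivAt x hPd
        have h2 := h1.neg.add ((hasDerivAt_id x).const_mul lam)
        refine h2.congr_deriv ?_
        have h3 : fderiv ℝ ψ (Phi o e x y) e = ⟪conjField u (Phi o e x y), e⟫ := by
          rw [← (hg _ hq).2, ← toDual_gradient]; simp
        have h4 : X (Phi o e x y) = nG u (Phi o e x y) + lam • rot e := by
          simp only [hXdef, hPhiw]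
          have := mul_nonneg hM hy2.1.le
          rw [Real.smoothTransition.one_of_one_le (by linarith [hy x hx hq]), one_smul]
        rw [h3, h4, inner_add_left, inner_smul_left, real_inner_self_eq_norm_sq, norm_rot, he,
          conjField_eq, inner2, inner2]
        simp
      · refine ContinuousOn.intervalIntegrable ?_
        rw [uIcc_of_le hab]
        refine ContinuousOn.inner (𝕜 := ℝ) ?_ continuousOn_const
        refine hX.continuousOn.comp (f := fun x => Phi o e x y) (t := Ω) ?_ hyi
        unfold Phi; fun_prop
    have hside : ∀ x, |∫ z in y..δ, ⟪X (Phi o e x z), e⟫| ≤ δ := by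
      intro x
      have := intervalIntegral.norm_integral_le_of_norm_le_const (a := y) (b := δ) (C := 1)
        (f := fun z => ⟪X (Phi o e x z), e⟫) (fun z _ => by simpa using hXe (Phi o e x z))
      rw [Real.norm_eq_abs, one_mul, abs_of_nonneg (sub_nonneg.2 hy2.2.le)] at this
      linarith [hy2.1]
    have s1 := (abs_le.1 (hside b)).2
    have s2 := (abs_le.1 (hside a)).1
    rw [htop, hbot] at h
    linarith
  have hT : ∀ x ∈ Icc a b, Tendsto (fun y => ψ (Phi o e x y)) (𝓝[>] (0 : ℝ))
      (𝓝 (ψ (Phi o e x 0))) := by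
    intro x hx
    have hc1 : Tendsto (fun y => Phi o e x y) (𝓝[>] (0 : ℝ)) (𝓝 (Phi o e x 0)) := by
      have : Continuous (fun y => Phi o e x y) := by unfold Phi; fun_prop
      exact (this.tendsto 0).mono_left nhdsWithin_le_nhds
    have hev2 : ∀ᶠ y in 𝓝[>] (0 : ℝ), Phi o e x y ∈ Ω := by
      filter_upwards [Ioo_mem_nhdsGT hδ] with y hy using hin x hx y ⟨hy.1, hy.2.le⟩
    have hcl : Phi o e x 0 ∈ closure Ω := mem_closure_of_tendsto hc1 hev2
    exact (hcont _ hcl).tendsto.comp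
      (tendsto_nhdsWithin_iff.2 ⟨hc1, hev2.mono fun y hy => subset_closure hy⟩)
  exact ge_of_tendsto ((hT b (right_mem_Icc.2 hab)).sub (hT a (left_mem_Icc.2 hab))) hmain

theorem flux_sub {Ω : Set Pt} {u ψ : Pt → ℝ} (hu : MinimalGraph Ω u)
    (hcont : ContinuousOn ψ (closure Ω)) (hg : IsConjugate Ω u ψ)
    (o e : Pt) (he : ‖e‖ = 1) {a b δ : ℝ} (hab : a ≤ b) (hδ : 0 < δ)
    (hin : ∀ x ∈ Icc a b, ∀ y ∈ Ioc 0 δ, Phi o e x y ∈ Ω)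
    (hlim : ∀ x ∈ Icc a b, Tendsto u (𝓝[Ω] (Phi o e x 0)) atTop) :
    b - a ≤ ψ (Phi o e b 0) - ψ (Phi o e a 0) := by
  refine le_of_forall_pos_le_add fun ε hε => ?_
  set d := min δ (ε / 4) with hd
  have hd0 : 0 < d := lt_min hδ (by linarith)
  have hd1 : d ≤ δ := min_le_left _ _
  have hd2 : d ≤ ε / 4 := min_le_right _ _
  set M := 2 * (b - a + 1) / ε + 1 with hMdef
  have hM : 0 < M := by
    have : 0 ≤ b - a := by linarith
    positivity
  have h := flux_M hu hcont hg o e he hab hd0 hM.le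
    (fun x hx y hy => hin x hx y ⟨hy.1, hy.2.trans hd1⟩) hlim
  have hs : Real.sqrt (1 + M ^ 2) ≤ 1 + M := by
    rw [Real.sqrt_le_left (by linarith)]; nlinarith
  have h1 : 1 - 1 / M ≤ M / Real.sqrt (1 + M ^ 2) := by
    have : M / (1 + M) ≤ M / Real.sqrt (1 + M ^ 2) := by
      apply div_le_div_of_nonneg_left hM.le (by positivity) hs
    refine le_trans ?_ this
    rw [sub_le_iff_le_add, div_add_div _ _ (by positivity) (by positivity), le_div_iff₀ (by positivity)]
    nlinarith
  have h2 : (b - a) * (1 / M) ≤ ε / 2 := by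
    rw [mul_one_div, div_le_iff₀ hM, hMdef]
    have : ε / 2 * (2 * (b - a + 1) / ε + 1) = b - a + 1 + ε / 2 := by field_simp
    linarith
  have h3 := mul_le_mul_of_nonneg_right h1 (sub_nonneg.2 hab)
  nlinarith

theorem second_deriv_le {f f' : ℝ → ℝ} {m : ℝ} (h1 : ∀ᶠ t in 𝓝 (0 : ℝ), HasDerivAt f (f' t) t)
    (h2 : HasDerivAt f' m 0) (hmax : IsLocalMax f 0) : m ≤ 0 := by
  by_contra hm
  push Not at hm
  have he : deriv f =ᶠ[𝓝 0] f' := h1.mono fun t ht => ht.deriv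
  have hdd : deriv (deriv f) 0 = m := by rw [he.deriv_eq]; exact h2.deriv
  have hmin : IsLocalMin f 0 := isLocalMin_of_deriv_deriv_pos (by rw [hdd]; exact hm)
    hmax.deriv_eq_zero h1.self_of_nhds.continuousAt
  have hc : f =ᶠ[𝓝 0] fun _ => f 0 := by
    filter_upwards [hmax, hmin] with t a b using le_antisymm a b
  have h3 : deriv (deriv f) 0 = 0 := by
    rw [hc.deriv.deriv_eq]; simp
  rw [hdd] at h3
  linarith

theorem Wu_sq (u : Pt → ℝ) (q : Pt) : Wu u q ^ 2 = 1 + ‖gradient u q‖ ^ 2 :=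
  Real.sq_sqrt (by positivity)

theorem conj_identity (u : Pt → ℝ) (q : Pt) :
    Wu u q ^ 2 * (1 - ‖conjField u q‖ ^ 2) = 1 := by
  have h0 := (Wu_pos u q).ne'
  have h := Wu_sq u q
  rw [conjField, norm_smul, mul_pow, norm_inv, Real.norm_of_nonneg (Wu_pos u q).le]
  have : ‖vec2 (-(gradient u q 1)) (gradient u q 0)‖ ^ 2 = ‖gradient u q‖ ^ 2 := by
    rw [normsq2, normsq2]; simp; ring
  rw [this]
  field_simp
  linarith

theorem conj_contDiffOn {Ω : Set Pt} {u : Pt → ℝ} (ho : IsOpen Ω) (hu : ContDiffOn ℝ 2 u Ω) :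
    ContDiffOn ℝ 1 (conjField u) Ω := by
  have h := nG_contDiffOn ho hu
  rw [contDiffOn_euclidean] at h ⊢
  intro i
  fin_cases i
  · simpa [conjField_eq] using (h 1).neg
  · simpa [conjField_eq] using h 0

theorem hess_identity {Ω : Set Pt} {u : Pt → ℝ} (ho : IsOpen Ω) (hu : ContDiffOn ℝ 2 u Ω)
    {p : Pt} (hp : p ∈ Ω) :
    dv (conjField u) p +
      Wu u p ^ 2 * ⟪conjField u p, fderiv ℝ (conjField u) p (conjField u p)⟫ = 0 := by
  have hnb := ho.mem_nhds hp
  have hC : HasFDerivAt (conjField u) (fderiv ℝ (conjField u) p) p :=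
    (((conj_contDiffOn ho hu).differentiableOn one_ne_zero).differentiableAt hnb).hasFDerivAt
  have hW : HasFDerivAt (Wu u) (fderiv ℝ (Wu u) p) p :=
    (((Wu_contDiffOn ho hu).differentiableOn one_ne_zero).differentiableAt hnb).hasFDerivAt
  have hW0 := Wu_pos u p
  have hid := conj_identity u p
  -- derivative of W
  have hWd : ∀ v, fderiv ℝ (Wu u) p v =
      Wu u p ^ 3 * ⟪conjField u p, fderiv ℝ (conjField u) p v⟫ := by
    intro v
    have h1 := (hW.pow 2).mul (hC.norm_sq.const_sub 1)
    have h2 : HasFDerivAt (fun _ : Pt => (1 : ℝ)) (0 : Pt →L[ℝ] ℝ) p := hasFDerivAt_const _ _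
    have h3 := h1.unique (h2.congr_of_eventuallyEq (Eventually.of_forall fun q => by
      simpa using conj_identity u q))
    have h4 := DFunLike.congr_fun h3 v
    simp at h4
    set a := ⟪conjField u p, fderiv ℝ (conjField u) p v⟫
    set w := fderiv ℝ (Wu u) p v
    set W := Wu u p
    have h5 : W * (2 * (w * (W ^ 2 * (1 - ‖conjField u p‖ ^ 2)) - W ^ 3 * a)) = 0 := by
      linear_combination W ^ 2 * h4
    rw [hid, mul_one] at h5
    have := (mul_eq_zero.1 h5).resolve_left hW0.ne'
    linarith
  -- the rotated gradient is divergence free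
  have hY : HasFDerivAt (fun q => rot (gradient u q)) (Wu u p • fderiv ℝ (conjField u) p +
      (fderiv ℝ (Wu u) p).smulRight (conjField u p)) p := by
    have h1 : HasFDerivAt (fun q => Wu u q • conjField u q) _ p := hW.smul hC
    refine h1.congr_of_eventuallyEq (Eventually.of_forall fun q => ?_)
    simp only [conjField, smul_smul, mul_inv_cancel₀ (Wu_pos u q).ne', one_smul, rot]
  have hgi : ∀ q i, gradient u q i = fderiv ℝ u q (EuclideanSpace.single i 1) := by
    intro q i
    rw [← toDual_gradient, InnerProductSpace.toDual_apply_apply, inner2]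
    fin_cases i <;> simp
  have hD : HasFDerivAt (fderiv ℝ u) (fderiv ℝ (fderiv ℝ u) p) p :=
    (((hu.fderiv_of_isOpen ho (m := 1) (by norm_num)).differentiableOn
      one_ne_zero).differentiableAt hnb).hasFDerivAt
  have hsym : IsSymmSndFDerivAt ℝ u p :=
    (hu.contDiffAt hnb).isSymmSndFDerivAt (by simp)
  have hcomp : ∀ i : Fin 2, HasFDerivAt (fun q => rot (gradient u q) i)
      ((EuclideanSpace.proj (𝕜 := ℝ) i).comp (Wu u p • fderiv ℝ (conjField u) p +
      (fderiv ℝ (Wu u) p).smulRight (conjField u p))) p := fun i =>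
    (EuclideanSpace.proj (𝕜 := ℝ) i).hasFDerivAt.comp p hY
  have hD' : ∀ v, HasFDerivAt (fun q => fderiv ℝ u q v) ((fderiv ℝ (fderiv ℝ u) p).flip v) p := by
    intro v
    simpa using hD.clm_apply (hasFDerivAt_const v p)
  have e0 := (hcomp 0).unique ((hD' (EuclideanSpace.single 1 1)).neg.congr_of_eventuallyEq
    (Eventually.of_forall fun q => by simp [hgi]))
  have e1 := (hcomp 1).unique ((hD' (EuclideanSpace.single 0 1)).congr_of_eventuallyEq
    (Eventually.of_forall fun q => by simp [hgi]))
  have f0 := DFunLike.congr_fun e0 (EuclideanSpace.single 0 1)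
  have f1 := DFunLike.congr_fun e1 (EuclideanSpace.single 1 1)
  have hs := hsym.eq (EuclideanSpace.single 0 1) (EuclideanSpace.single 1 1)
  simp [hWd] at f0 f1
  rw [dv, Fin.sum_univ_two]
  have hl : ∀ v : Pt, ⟪conjField u p, fderiv ℝ (conjField u) p v⟫ =
      v 0 * ⟪conjField u p, fderiv ℝ (conjField u) p (EuclideanSpace.single 0 1)⟫ +
      v 1 * ⟪conjField u p, fderiv ℝ (conjField u) p (EuclideanSpace.single 1 1)⟫ := by
    intro v
    conv_lhs => rw [pt_decomp v]
    rw [map_add, map_smul, map_smul, inner_add_right, inner_smul_right, inner_smul_right]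
  rw [hl (conjField u p)]
  apply mul_left_cancel₀ hW0.ne'
  linear_combination f0 + f1 - hs

theorem max_pr {Ω : Set Pt} {u ψ : Pt → ℝ} (hb : Bornology.IsBounded Ω) (ho : IsOpen Ω)
    (hu : ContDiffOn ℝ 2 u Ω)
    (hcont : ContinuousOn ψ (closure Ω)) (hg : IsConjugate Ω u ψ) (c : ℝ)
    (hbd : ∀ x ∈ frontier Ω, ψ x ≤ c) : ∀ x ∈ closure Ω, ψ x ≤ c := by
  intro x0 hx0
  by_contra hlt
  push Not at hlt
  have hcpt : IsCompact (closure Ω) := hb.isCompact_closure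
  obtain ⟨R, hR⟩ := hcpt.isBounded.exists_norm_le
  set ε := (ψ x0 - c) / (R ^ 2 + 1) with hε
  have hε0 : 0 < ε := div_pos (by linarith) (by positivity)
  have hεe : ε * (R ^ 2 + 1) = ψ x0 - c := by rw [hε]; field_simp
  obtain ⟨p, hpc, hpm⟩ := hcpt.exists_isMaxOn ⟨x0, hx0⟩
    (f := fun x => ψ x + ε * ‖x‖ ^ 2) (hcont.add (by fun_prop))
  have hp : p ∈ Ω := by
    by_contra hn
    have hf : p ∈ frontier Ω := by rw [ho.frontier_eq]; exact ⟨hpc, hn⟩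
    have h1 := hbd p hf
    have h2 : ψ x0 + ε * ‖x0‖ ^ 2 ≤ ψ p + ε * ‖p‖ ^ 2 := hpm hx0
    have h3 : ‖p‖ ^ 2 ≤ R ^ 2 := pow_le_pow_left₀ (norm_nonneg _) (hR p hpc) 2
    have h4 := mul_le_mul_of_nonneg_left h3 hε0.le
    have h5 : 0 ≤ ε * ‖x0‖ ^ 2 := by positivity
    linarith
  have hnb := ho.mem_nhds hp
  have hC : HasFDerivAt (conjField u) (fderiv ℝ (conjField u) p) p :=
    (((conj_contDiffOn ho hu).differentiableOn one_ne_zero).differentiableAt hnb).hasFDerivAt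
  have hdir : ∀ v : Pt, ⟪fderiv ℝ (conjField u) p v, v⟫ + ε * (2 * ‖v‖ ^ 2) ≤ 0 := by
    intro v
    have hl : ∀ t : ℝ, HasDerivAt (fun t : ℝ => p + t • v) v t := fun t => by
      simpa using ((hasDerivAt_id t).smul_const v).const_add p
    have hl0 : Tendsto (fun t : ℝ => p + t • v) (𝓝 0) (𝓝 p) := by
      simpa using (hl 0).continuousAt.tendsto
    refine second_deriv_le (f := fun t : ℝ => ψ (p + t • v) + ε * ‖p + t • v‖ ^ 2)
      (f' := fun t : ℝ => ⟪conjField u (p + t • v), v⟫ + ε * (2 * ⟪p + t • v, v⟫)) ?_ ?_ ?_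
    · filter_upwards [hl0.eventually hnb] with t ht
      have h1 := (hg _ ht).1.hasFDerivAt.comp_hasDerivAt t (hl t)
      have h3 : fderiv ℝ ψ (p + t • v) v = ⟪conjField u (p + t • v), v⟫ := by
        rw [← (hg _ ht).2, ← toDual_gradient]; simp
      rw [h3] at h1
      exact h1.add ((hl t).norm_sq.const_mul ε)
    · have hC' : HasFDerivAt (conjField u) (fderiv ℝ (conjField u) p) (p + (0 : ℝ) • v) := by
        simpa using hC
      have h1 := (hC'.comp_hasDerivAt (0 : ℝ) (hl 0)).inner ℝ (hasDerivAt_const (0 : ℝ) v)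
      have h2 := (((hl 0).inner ℝ (hasDerivAt_const (0 : ℝ) v)).const_mul 2).const_mul ε
      refine (h1.add h2).congr_deriv ?_
      simp
    · have : ∀ᶠ q in 𝓝 p, ψ q + ε * ‖q‖ ^ 2 ≤ ψ p + ε * ‖p‖ ^ 2 := by
        filter_upwards [hnb] with q hq using hpm (subset_closure hq)
      have := hl0.eventually this
      simpa [IsLocalMax, IsMaxFilter] using this
  have hid := hess_identity ho hu hp
  have d0 := hdir (EuclideanSpace.single 0 1)
  have d1 := hdir (EuclideanSpace.single 1 1)
  have d2 := hdir (conjField u p)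
  rw [dv, Fin.sum_univ_two] at hid
  rw [inner2] at d0 d1
  simp at d0 d1
  have h6 : ⟪conjField u p, fderiv ℝ (conjField u) p (conjField u p)⟫ ≤ 0 := by
    rw [real_inner_comm]
    have : 0 ≤ ε * (2 * ‖conjField u p‖ ^ 2) := by positivity
    linarith
  have h7 := mul_nonpos_of_nonneg_of_nonpos (sq_nonneg (Wu u p)) h6
  linarith

theorem lip {Ω : Set Pt} {u ψ : Pt → ℝ} (hconv : Convex ℝ Ω)
    (hcont : ContinuousOn ψ (closure Ω)) (hg : IsConjugate Ω u ψ) {x y : Pt}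
    (hx : x ∈ closure Ω) (hy : y ∈ closure Ω) : ψ x - ψ y ≤ ‖x - y‖ := by
  have h : LipschitzOnWith 1 ψ Ω := by
    refine hconv.lipschitzOnWith_of_nnnorm_fderiv_le (fun q hq => (hg q hq).1) fun q hq => ?_
    rw [← toDual_gradient, (hg q hq).2]
    have := norm_conjField_le u q
    rw [← NNReal.coe_le_coe]
    simpa using this
  have h2 := (h.closure hcont).dist_le_mul x hx y hy
  rw [NNReal.coe_one, one_mul, Real.dist_eq, dist_eq_norm] at h2
  exact (le_abs_self _).trans h2

theorem cross2_eq (e w : Pt) : cross2 e w = ⟪rot e, w⟫ := by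
  rw [inner2, cross2]; simp; ring

theorem frame_decomp (e w : Pt) (he : ‖e‖ = 1) : w = ⟪e, w⟫ • e + ⟪rot e, w⟫ • rot e := by
  have h := normsq2 e
  rw [he] at h
  rw [inner2, inner2]
  ext i
  fin_cases i <;> simp
  · linear_combination (w 0) * h
  · linear_combination (w 1) * h

theorem side {Ω : Set Pt} (ho : IsOpen Ω) (hconv : Convex ℝ Ω) (hne : Ω.Nonempty) {o e : Pt}
    (he : ‖e‖ = 1) (hs : segment ℝ o (o + e) ⊆ frontier Ω) :
    (∀ x ∈ Ω, 0 < ⟪rot e, x - o⟫) ∨ (∀ x ∈ Ω, ⟪rot e, x - o⟫ < 0) := by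
  have hm : o + (1 / 2 : ℝ) • e ∈ segment ℝ o (o + e) := by
    rw [segment_eq_image']
    exact ⟨1 / 2, by norm_num, by simp⟩
  have hmf := hs hm
  rw [ho.frontier_eq] at hs hmf
  obtain ⟨f, hf⟩ := geometric_hahn_banach_open_point hconv ho hmf.2
  have hcl : ∀ x ∈ closure Ω, f x ≤ f (o + (1 / 2 : ℝ) • e) := by
    intro x hx
    exact closure_minimal (fun a ha => (hf a ha).le)
      (isClosed_le f.continuous continuous_const) hx
  have h1 := hcl o (hs (left_mem_segment ℝ _ _)).1
  have h2 := hcl (o + e) (hs (right_mem_segment ℝ _ _)).1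
  simp only [map_add, map_smul, smul_eq_mul] at h1 h2 hf
  have hfe : f e = 0 := by linarith
  have hfx : ∀ x, f (x - o) = ⟪rot e, x - o⟫ * f (rot e) := by
    intro x
    conv_lhs => rw [frame_decomp e (x - o) he]
    rw [map_add, map_smul, map_smul, hfe]; simp
  have hneg : ∀ x ∈ Ω, ⟪rot e, x - o⟫ * f (rot e) < 0 := by
    intro x hx
    rw [← hfx, map_sub]
    have := hf x hx
    rw [hfe] at this
    linarith
  rcases lt_trichotomy (f (rot e)) 0 with h | h | h
  · left; intro x hx
    by_contra hn
    push Not at hn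
    have := mul_nonneg_of_nonpos_of_nonpos hn h.le
    linarith [hneg x hx]
  · obtain ⟨x, hx⟩ := hne
    have := hneg x hx
    rw [h, mul_zero] at this
    exact absurd this (lt_irrefl _)
  · right; intro x hx
    by_contra hn
    push Not at hn
    have := mul_nonneg hn h.le
    linarith [hneg x hx]

theorem edge_rect {Ω : Set Pt} (ho : IsOpen Ω) (hconv : Convex ℝ Ω) (hne : Ω.Nonempty) {o e : Pt}
    (he : ‖e‖ = 1) (hs : ∀ s ∈ Icc (0 : ℝ) 1, Phi o e s 0 ∈ closure Ω)
    (hleft : ∀ x ∈ Ω, 0 < ⟪rot e, x - o⟫) {a b : ℝ} (ha : 0 < a) (hb : b < 1) (hab : a ≤ b) :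
    ∃ δ > 0, ∀ x ∈ Icc a b, ∀ y ∈ Ioc 0 δ, Phi o e x y ∈ Ω := by
  obtain ⟨z, hz⟩ := hne
  have hy0 := hleft z hz
  have hzd := frame_decomp e (z - o) he
  set y0 := ⟪rot e, z - o⟫
  set x0 := ⟪e, z - o⟫
  set m := min a (1 - b) with hm
  have hm0 : 0 < m := lt_min ha (by linarith)
  have hma : m ≤ a := min_le_left _ _
  have hmb : m ≤ 1 - b := min_le_right _ _
  refine ⟨y0 * (m / (2 * (|x0| + 1))), by positivity, fun x hx y hy => ?_⟩
  set t := y / y0 with ht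
  have hty : t * y0 = y := by rw [ht]; field_simp
  have ht0 : 0 < t := div_pos hy.1 hy0
  have htm : t * (|x0| + 1) ≤ m / 2 := by
    have : t ≤ m / (2 * (|x0| + 1)) := by
      rw [ht, div_le_iff₀ hy0, mul_comm]; exact hy.2
    calc t * (|x0| + 1) ≤ m / (2 * (|x0| + 1)) * (|x0| + 1) := by gcongr
      _ = m / 2 := by field_simp
  have hax : 0 ≤ t * |x0| := by positivity
  have hb1 : |t * x0| = t * |x0| := by rw [abs_mul, abs_of_pos ht0]
  have hb2 := abs_le.1 hb1.le
  have ht1 : t < 1 := by linarith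
  have h1t : 0 < 1 - t := by linarith
  set s := (x - t * x0) / (1 - t) with hsdef
  have hs1 : (1 - t) * s = x - t * x0 := by rw [hsdef]; field_simp
  have hsI : s ∈ Icc (0 : ℝ) 1 := by
    constructor
    · apply div_nonneg _ h1t.le; linarith [hx.1, hb2.2]
    · rw [hsdef, div_le_one h1t]; linarith [hx.2, hb2.1]
  have := hconv.combo_interior_closure_mem_interior (ho.interior_eq.symm ▸ hz) (hs s hsI)
    ht0 h1t.le (by ring)
  rw [ho.interior_eq] at this
  convert this using 1
  have hzz : z = o + (x0 • e + y0 • rot e) := by rw [← hzd]; abel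
  rw [hzz]
  unfold Phi
  have e1 : x = t * x0 + (1 - t) * s := by rw [hs1]; ring
  rw [← hty, e1]
  module

theorem edge_full {Ω : Set Pt} {u ψ : Pt → ℝ} (hu : MinimalGraph Ω u) (hconv : Convex ℝ Ω)
    (hne : Ω.Nonempty) (hcont : ContinuousOn ψ (closure Ω)) (hg : IsConjugate Ω u ψ)
    {o e : Pt} (he : ‖e‖ = 1) (hs : ∀ s ∈ Icc (0 : ℝ) 1, Phi o e s 0 ∈ closure Ω)
    (hleft : ∀ x ∈ Ω, 0 < ⟪rot e, x - o⟫)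
    (hlim : ∀ x ∈ Ioo (0 : ℝ) 1, Tendsto u (𝓝[Ω] (Phi o e x 0)) atTop) :
    ∀ t ∈ Icc (0 : ℝ) 1, ψ (Phi o e t 0) = ψ (Phi o e 0 0) + t := by
  have hl : ∀ a ∈ Icc (0 : ℝ) 1, ∀ b ∈ Icc (0 : ℝ) 1, a ≤ b →
      ψ (Phi o e b 0) - ψ (Phi o e a 0) ≤ b - a := by
    intro a ha b hb hab
    refine (lip hconv hcont hg (hs b hb) (hs a ha)).trans ?_
    have : Phi o e b 0 - Phi o e a 0 = (b - a) • e := by unfold Phi; module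
    rw [this, norm_smul, he, mul_one, Real.norm_of_nonneg (by linarith)]
  have h01 : 1 ≤ ψ (Phi o e 1 0) - ψ (Phi o e 0 0) := by
    refine le_of_forall_pos_le_add fun ε hε => ?_
    set r := min (1 / 4 : ℝ) (ε / 8) with hr
    have hr0 : 0 < r := lt_min (by norm_num) (by linarith)
    have hr1 : r ≤ 1 / 4 := min_le_left _ _
    have hr2 : r ≤ ε / 8 := min_le_right _ _
    have hab : r ≤ 1 - r := by linarith
    obtain ⟨δ, hδ, hin⟩ := edge_rect hu.1 hconv hne he hs hleft hr0
      (b := 1 - r) (by linarith) hab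
    have h := flux_sub hu hcont hg o e he hab hδ hin
      (fun x hx => hlim x ⟨by linarith [hx.1], by linarith [hx.2]⟩)
    have m1 : (1 - r) ∈ Icc (0 : ℝ) 1 := ⟨by linarith, by linarith⟩
    have m2 : r ∈ Icc (0 : ℝ) 1 := ⟨by linarith, by linarith⟩
    have i1 : ψ (Phi o e (1 - r) 0) - ψ (Phi o e 1 0) ≤ r := by
      refine (lip hconv hcont hg (hs _ m1) (hs 1 (by simp))).trans ?_
      have : Phi o e (1 - r) 0 - Phi o e 1 0 = (-r) • e := by unfold Phi; module
      rw [this, norm_smul, he, mul_one, norm_neg, Real.norm_of_nonneg hr0.le]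
    have i2 : ψ (Phi o e 0 0) - ψ (Phi o e r 0) ≤ r := by
      refine (lip hconv hcont hg (hs 0 (by simp)) (hs _ m2)).trans ?_
      have : Phi o e 0 0 - Phi o e r 0 = (-r) • e := by unfold Phi; module
      rw [this, norm_smul, he, mul_one, norm_neg, Real.norm_of_nonneg hr0.le]
    linarith
  intro t ht
  have a1 := hl 0 (by simp) t ht ht.1
  have a2 := hl t ht 1 (by simp) ht.2
  linarith

theorem gradient_neg' (u : Pt → ℝ) (q : Pt) : gradient (fun x => -u x) q = -gradient u q := by
  unfold gradient
  rw [fderiv_fun_neg, map_neg]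

theorem Wu_neg (u : Pt → ℝ) (q : Pt) : Wu (fun x => -u x) q = Wu u q := by
  unfold Wu
  rw [gradient_neg', norm_neg]

theorem minimal_neg {Ω : Set Pt} {u : Pt → ℝ} (hu : MinimalGraph Ω u) :
    MinimalGraph Ω (fun x => -u x) := by
  refine ⟨hu.1, hu.2.1.neg, fun p hp => ?_⟩
  have h := hu.2.2 p hp
  simp only [gradient_neg', Wu_neg, smul_neg, fderiv_fun_neg]
  rw [Fin.sum_univ_two] at h ⊢
  simp only [neg_apply, PiLp.neg_apply]
  linarith

theorem conj_neg {Ω : Set Pt} {u ψ : Pt → ℝ} (hg : IsConjugate Ω u ψ) :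
    IsConjugate Ω (fun x => -u x) (fun x => -ψ x) := by
  intro p hp
  refine ⟨(hg p hp).1.neg, ?_⟩
  rw [gradient_neg', (hg p hp).2]
  unfold conjField
  rw [Wu_neg, gradient_neg']
  ext i
  fin_cases i <;> simp

section Poly

variable {n : ℕ} (P : UnitPolygon n)

/-- The edge vector. -/
def ed (i : ZMod (2 * n)) : Pt := P.vtx (i + 1) - P.vtx i

theorem ed_norm (i : ZMod (2 * n)) : ‖ed P i‖ = 1 := by
  rw [ed, ← dist_eq_norm, dist_comm]; exact P.unit_edges i

theorem vtx_succ (i : ZMod (2 * n)) : P.vtx (i + 1) = P.vtx i + ed P i := by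
  rw [ed]; abel

theorem seg_frontier (i : ZMod (2 * n)) :
    segment ℝ (P.vtx i) (P.vtx i + ed P i) ⊆ frontier P.Ω := by
  rw [← vtx_succ, P.frontier_eq]
  exact subset_iUnion (fun i => segment ℝ (P.vtx i) (P.vtx (i + 1))) i

theorem vtx_closure (i : ZMod (2 * n)) : P.vtx i ∈ closure P.Ω :=
  frontier_subset_closure (seg_frontier P i (left_mem_segment ℝ _ _))

theorem right_step (i : ZMod (2 * n)) (h : ∀ x ∈ P.Ω, ⟪rot (ed P i), x - P.vtx i⟫ < 0) :
    ed P (i + 1) = ed P i ∧ ∀ x ∈ P.Ω, ⟪rot (ed P (i + 1)), x - P.vtx (i + 1)⟫ < 0 := by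
  have hcl : ⟪rot (ed P i), P.vtx (i + 1 + 1) - P.vtx i⟫ ≤ 0 := by
    refine closure_minimal (s := P.Ω) (t := {x | ⟪rot (ed P i), x - P.vtx i⟫ ≤ 0})
      (fun a ha => (h a ha).le) ?_ (vtx_closure P (i + 1 + 1))
    exact isClosed_le (by fun_prop) continuous_const
  rw [vtx_succ P (i + 1), vtx_succ P i,
    show P.vtx i + ed P i + ed P (i + 1) - P.vtx i = ed P i + ed P (i + 1) by abel,
    inner_add_right, inner_rot_self, zero_add] at hcl
  have hpos := P.pos_orient i
  rw [show i + 2 = i + 1 + 1 by ring] at hpos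
  change 0 ≤ cross2 (ed P i) (ed P (i + 1)) at hpos
  rw [cross2_eq] at hpos
  have h0 : ⟪rot (ed P i), ed P (i + 1)⟫ = 0 := le_antisymm hcl hpos
  have hd := frame_decomp (ed P i) (ed P (i + 1)) (ed_norm P i)
  rw [h0, zero_smul, add_zero] at hd
  have hn := ed_norm P (i + 1)
  rw [hd, norm_smul, ed_norm, mul_one, Real.norm_eq_abs] at hn
  have heq : ed P (i + 1) = ed P i := by
    rcases (abs_eq zero_le_one).1 hn with h1 | h1
    · rw [hd, h1, one_smul]
    · exfalso
      rw [h1, neg_one_smul] at hd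
      have hv : P.vtx (i + 1 + 1) = P.vtx i := by
        rw [vtx_succ P (i + 1), hd, vtx_succ P i]; abel
      have h2 := P.inj hv
      have h3 : ((2 : ℕ) : ZMod (2 * n)) = 0 := by
        push_cast
        linear_combination h2
      rw [ZMod.natCast_eq_zero_iff] at h3
      have := Nat.le_of_dvd (by norm_num) h3
      have := P.n_ge
      omega
  refine ⟨heq, fun x hx => ?_⟩
  rw [heq, vtx_succ, show x - (P.vtx i + ed P i) = (x - P.vtx i) - ed P i by abel,
    inner_sub_right, inner_rot_self, sub_zero]
  exact h x hx

theorem left_all (i : ZMod (2 * n)) : ∀ x ∈ P.Ω, 0 < ⟪rot (ed P i), x - P.vtx i⟫ := by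
  refine (side P.isOpen P.convex P.nonempty (ed_norm P i) (seg_frontier P i)).resolve_right ?_
  intro h
  have hk : ∀ k : ℕ, ed P (i + k) = ed P i ∧ P.vtx (i + k) = P.vtx i + (k : ℝ) • ed P i ∧
      ∀ x ∈ P.Ω, ⟪rot (ed P (i + k)), x - P.vtx (i + k)⟫ < 0 := by
    intro k
    induction k with
    | zero => simpa using h
    | succ k ih =>
      obtain ⟨h1, h2, h3⟩ := ih
      have := right_step P _ h3
      rw [Nat.cast_succ, ← add_assoc]
      refine ⟨this.1.trans h1, ?_, this.2⟩
      rw [vtx_succ, h2, h1]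
      push_cast
      module
  have h2 := (hk (2 * n)).2.1
  rw [ZMod.natCast_self, add_zero] at h2
  have h3 : ((2 * n : ℕ) : ℝ) • ed P i = 0 := by simpa using h2
  rcases smul_eq_zero.1 h3 with h4 | h4
  · have := P.n_ge
    rw [Nat.cast_eq_zero] at h4
    omega
  · have := ed_norm P i
    rw [h4, norm_zero] at this
    exact zero_ne_one this

theorem Phi_edge (i : ZMod (2 * n)) (t : ℝ) :
    Phi (P.vtx i) (ed P i) t 0 = (1 - t) • P.vtx i + t • P.vtx (i + 1) := by
  unfold Phi ed; module

theorem Phi_closure (i : ZMod (2 * n)) : ∀ s ∈ Icc (0 : ℝ) 1,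
    Phi (P.vtx i) (ed P i) s 0 ∈ closure P.Ω := by
  intro s hs
  apply frontier_subset_closure
  rw [P.frontier_eq, Phi_edge]
  exact mem_iUnion.2 ⟨i, 1 - s, s, by linarith [hs.2], hs.1, by ring, rfl⟩

end Poly

/-- For a Jenkins–Serrin graph on a non-special unit polygon, the continuous extension
`ψ̄` of a conjugate function normalized by `ψ̄(p₀) = 0` takes the value `0` at every even
vertex and `1` at every odd vertex, is affine on each boundary edge, and satisfies
`0 ≤ ψ̄ ≤ 1` on the closure of the domain. -/
theorem conjugate_boundary_values_on_polygon
    (n : ℕ) (P : UnitPolygon n) (hns : ¬ P.IsSpecial)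
    (u ψb : Pt → ℝ) (hu : JSGraph P u)
    (hcont : ContinuousOn ψb (closure P.Ω))
    (hgrad : ∀ p ∈ P.Ω, DifferentiableAt ℝ ψb p ∧ gradient ψb p = conjField u p)
    (hnorm : ψb (P.vtx 0) = 0) :
    (∀ i : ZMod (2 * n),
      (Even i.val → ψb (P.vtx i) = 0) ∧ (¬ Even i.val → ψb (P.vtx i) = 1)) ∧
    (∀ i : ZMod (2 * n), ∀ t ∈ Icc (0:ℝ) 1,
      ψb ((1 - t) • P.vtx i + t • P.vtx (i + 1)) =
        (1 - t) * ψb (P.vtx i) + t * ψb (P.vtx (i + 1))) ∧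
    (∀ x ∈ closure P.Ω, ψb x ∈ Icc (0:ℝ) 1) := by
  obtain ⟨hmin, hlim⟩ := hu
  have hn2 := P.n_ge
  have : NeZero (2 * n) := ⟨by omega⟩
  have hg : IsConjugate P.Ω u ψb := hgrad
  have hmem : ∀ i, ∀ x ∈ Ioo (0 : ℝ) 1,
      Phi (P.vtx i) (ed P i) x 0 ∈ openSegment ℝ (P.vtx i) (P.vtx (i + 1)) := by
    intro i x hx
    rw [Phi_edge]
    exact ⟨1 - x, x, by linarith [hx.2], hx.1, by ring, rfl⟩
  have hev : ∀ i : ZMod (2 * n), Even i.val → ∀ t ∈ Icc (0 : ℝ) 1,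
      ψb ((1 - t) • P.vtx i + t • P.vtx (i + 1)) = ψb (P.vtx i) + t := by
    intro i hi t ht
    have := edge_full hmin P.convex P.nonempty hcont hg (ed_norm P i) (Phi_closure P i)
      (left_all P i) (fun x hx => (hlim i _ (hmem i x hx)).1 hi) t ht
    simpa [Phi_edge] using this
  have hod : ∀ i : ZMod (2 * n), ¬ Even i.val → ∀ t ∈ Icc (0 : ℝ) 1,
      ψb ((1 - t) • P.vtx i + t • P.vtx (i + 1)) = ψb (P.vtx i) - t := by
    intro i hi t ht
    have := edge_full (minimal_neg hmin) P.convex P.nonempty hcont.neg (conj_neg hg)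
      (ed_norm P i) (Phi_closure P i) (left_all P i)
      (fun x hx => tendsto_neg_atBot_atTop.comp ((hlim i _ (hmem i x hx)).2 hi)) t ht
    simp [Phi_edge] at this
    linarith
  have hnat : ∀ k : ℕ, k < 2 * n →
      (Even k → ψb (P.vtx k) = 0) ∧ (¬ Even k → ψb (P.vtx k) = 1) := by
    intro k
    induction k with
    | zero => intro _; simpa using hnorm
    | succ k ih =>
      intro hk
      have hk' : k < 2 * n := by omega
      have hv : ((k : ZMod (2 * n))).val = k := ZMod.val_cast_of_lt hk'
      obtain ⟨i1, i2⟩ := ih hk'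
      rw [Nat.cast_succ, Nat.even_add_one]
      constructor
      · intro ho
        have := hod k (by rwa [hv]) 1 (by simp)
        simp only [sub_self, zero_smul, one_smul, zero_add] at this
        rw [this, i2 ho]; ring
      · intro he
        rw [not_not] at he
        have := hev k (by rwa [hv]) 1 (by simp)
        simp only [sub_self, zero_smul, one_smul, zero_add] at this
        rw [this, i1 he]; ring
  have hvert : ∀ i : ZMod (2 * n),
      (Even i.val → ψb (P.vtx i) = 0) ∧ (¬ Even i.val → ψb (P.vtx i) = 1) := by
    intro i
    have := hnat i.val (ZMod.val_lt i)
    rwa [ZMod.natCast_zmod_val] at this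
  have hbd : ∀ x ∈ frontier P.Ω, 0 ≤ ψb x ∧ ψb x ≤ 1 := by
    intro x hx
    rw [P.frontier_eq] at hx
    obtain ⟨i, s, t, hs, ht, hst, rfl⟩ := mem_iUnion.1 hx
    obtain rfl : s = 1 - t := by linarith
    by_cases hi : Even i.val
    · rw [hev i hi t ⟨ht, by linarith⟩, (hvert i).1 hi]
      constructor <;> linarith
    · rw [hod i hi t ⟨ht, by linarith⟩, (hvert i).2 hi]
      constructor <;> linarith
  refine ⟨hvert, ?_, ?_⟩
  · intro i t ht
    by_cases hi : Even i.val
    · have h1 := hev i hi 1 (by simp)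
      simp only [sub_self, zero_smul, one_smul, zero_add] at h1
      rw [hev i hi t ht, h1]; ring
    · have h1 := hod i hi 1 (by simp)
      simp only [sub_self, zero_smul, one_smul, zero_add] at h1
      rw [hod i hi t ht, h1]; ring
  · intro x hx
    constructor
    · have : -ψb x ≤ 0 := max_pr (ψ := fun z => -ψb z) P.isBounded P.isOpen (minimal_neg hmin).2.1 hcont.neg (conj_neg hg) 0
        (fun y hy => by linarith [(hbd y hy).1]) x hx
      linarith
    · exact max_pr P.isBounded P.isOpen hmin.2.1 hcont hg 1 (fun y hy => (hbd y hy).2) x hx
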